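/- Assume ‖·‖ is an admissible norm on ℝ³ and let f : M → ℝ³ be an immersed surface with Birkhoff normal field η. A point p ∈ M is umbilic if and only if the Minkowski normal curvature k_{M,p} is constant on T_pM \ {0}; in this case the constant value of k_{M,p} equals the common principal curvature of M at p. -/

import Mathlib

/-!
Differential geometry of immersed surfaces in three-dimensional normed
(Minkowski) spaces, following Balestro–Martini–Teixeira.

`E3 = ℝ³` carries its standard Euclidean inner product and, in addition, a
norm `N` which is strictly convex and smooth.  Surfaces are given in a local
parametrization `f : P2 → E3` (an immersion on an open set `U`), endowed with
a Birkhoff normal field `η`.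
-/

noncomputable section

open scoped InnerProductSpace

abbrev E3 := EuclideanSpace ℝ (Fin 3)
abbrev P2 := EuclideanSpace ℝ (Fin 2)

/-- A smooth, strictly convex norm on `ℝ³` (a Minkowski norm). -/
structure MinkowskiNorm3 where
  N : E3 → ℝ
  nonneg : ∀ x, 0 ≤ N x
  eq_zero_iff : ∀ x, N x = 0 ↔ x = 0
  smul_eq : ∀ (c : ℝ) (x : E3), N (c • x) = |c| * N x
  triangle : ∀ x y, N (x + y) ≤ N x + N y
  strict_triangle : ∀ x y : E3, LinearIndependent ℝ ![x, y] → N (x + y) < N x + N y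
  smooth : ContDiffOn ℝ (⊤ : ℕ∞) N {x : E3 | x ≠ 0}

namespace MinkowskiNorm3

/-- Birkhoff orthogonality of a vector `v` to a set (e.g. a plane) `H`:
`‖v + w‖ ≥ ‖v‖` for all `w ∈ H`. -/
def BirkhoffOrth (m : MinkowskiNorm3) (v : E3) (H : Set E3) : Prop :=
  ∀ w ∈ H, m.N v ≤ m.N (v + w)

/-- The (outward) Euclidean Gauss map of the unit sphere `∂B` of the norm,
expressed on ambient space as the normalized gradient of `N`.  Restricted to
`∂B` it is the map `u⁻¹ : ∂B → ∂B_e`, whose inverse is `u : ∂B_e → ∂B`. -/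
def sphereGauss (m : MinkowskiNorm3) (v : E3) : E3 :=
  ‖gradient m.N v‖⁻¹ • gradient m.N v

/-- The differential `du⁻¹` at a point `v ∈ ∂B`, applied to a vector `w`
(its restriction to the tangent plane of `∂B` at `v` is the inverse of
`du_{u⁻¹(v)}`). -/
def duInv (m : MinkowskiNorm3) (v w : E3) : E3 :=
  fderiv ℝ m.sphereGauss v w

/-- Admissibility of the norm: the unit sphere `∂B` has positive Euclidean
Gaussian curvature at every point; equivalently, the second fundamental form
of `∂B` with respect to the outward normal is positive definite, i.e.
`⟪du⁻¹ w, w⟫ > 0` for every nonzero vector `w` tangent to `∂B`. -/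
def Admissible (m : MinkowskiNorm3) : Prop :=
  ∀ v : E3, m.N v = 1 → ∀ w : E3, w ≠ 0 → fderiv ℝ m.N v w = 0 →
    0 < ⟪m.duInv v w, w⟫_ℝ

end MinkowskiNorm3

/-- An immersed surface (in a local parametrization on an open set `U ⊆ ℝ²`)
in the Minkowski space `(ℝ³, m)`, endowed with a Birkhoff normal vector
field `η`: a smooth unit field with `η(p) ⊣_B T_pM` for all `p`. -/
structure BSurface (m : MinkowskiNorm3) where
  U : Set P2
  isOpen : IsOpen U
  f : P2 → E3
  smooth_f : ContDiffOn ℝ (⊤ : ℕ∞) f U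
  immersion : ∀ p ∈ U, Function.Injective (fderiv ℝ f p)
  η : P2 → E3
  smooth_η : ContDiffOn ℝ (⊤ : ℕ∞) η U
  unit_η : ∀ p ∈ U, m.N (η p) = 1
  birkhoff : ∀ p ∈ U, m.BirkhoffOrth (η p) (Set.range (fderiv ℝ f p))

namespace BSurface

variable {m : MinkowskiNorm3}

/-- The tangent plane `T_pM`, identified (via the push-forward `df_p`) with a
linear plane in ambient `ℝ³`. -/
def tangent (S : BSurface m) (p : P2) : Set E3 := Set.range (fderiv ℝ S.f p)

/-- `h : P2 → P2 → ℝ` (in the parameter coordinates, i.e. `h v w` stands for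
`h(df_p v, df_p w)`) is the affine fundamental form of the immersion at `p`,
determined by the Gauss formula `D_X Y = ∇_X Y + h(X,Y) η`: for coordinate
directions `v, w`, the second derivative `D_v D_w f` minus `h v w • η p` is
tangential. -/
def IsAffineFundForm (S : BSurface m) (p : P2) (h : P2 → P2 → ℝ) : Prop :=
  ∀ v w : P2,
    fderiv ℝ (fun q => fderiv ℝ S.f q w) p v - h v w • S.η p ∈ S.tangent p

end BSurface

/-- The Minkowski normal curvature of the surface parametrized by `f` with
Birkhoff normal field `η`, at `p`, in the tangent direction `X = df_p v`:
`k_{M,p}(X) = ⟪du⁻¹_{η(p)} X, dη_p X⟫ / ⟪du⁻¹_{η(p)} X, X⟫`, using the natural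
identification of the parallel planes `T_pM ≅ T_{η(p)}∂B ≅ T_{ξ(p)}∂B_e`. -/
def normalCurv (m : MinkowskiNorm3) (f η : P2 → E3) (p v : P2) : ℝ :=
  ⟪m.duInv (η p) (fderiv ℝ f p v), fderiv ℝ η p v⟫_ℝ /
    ⟪m.duInv (η p) (fderiv ℝ f p v), fderiv ℝ f p v⟫_ℝ

namespace MinkowskiNorm3

variable (m : MinkowskiNorm3)

lemma ne_zero_of_unit {v : E3} (hv : m.N v = 1) : v ≠ 0 := by
  intro h
  rw [(m.eq_zero_iff v).2 h] at hv
  exact zero_ne_one hv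

lemma contDiffAt {v : E3} (hv : v ≠ 0) : ContDiffAt ℝ 2 m.N v :=
  contDiffAt_infty.1 (m.smooth.contDiffAt (isOpen_ne.mem_nhds hv)) 2

lemma differentiableAt {v : E3} (hv : v ≠ 0) : DifferentiableAt ℝ m.N v :=
  (m.contDiffAt hv).differentiableAt (by simp)

lemma differentiableAt_fderiv {v : E3} (hv : v ≠ 0) :
    DifferentiableAt ℝ (fderiv ℝ m.N) v :=
  ((m.contDiffAt hv).fderiv_right (m := 1) one_add_one_eq_two.le).differentiableAt (by simp)

lemma isSymmSndFDerivAt {v : E3} (hv : v ≠ 0) : IsSymmSndFDerivAt ℝ m.N v :=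
  (m.contDiffAt hv).isSymmSndFDerivAt (by simp)

/-- Euler's identity for the norm. -/
lemma fderiv_apply_self {v : E3} (hv : v ≠ 0) : fderiv ℝ m.N v v = m.N v := by
  have hline : HasDerivAt (fun t : ℝ => v + t • v) v 0 := by
    simpa using ((hasDerivAt_id (0 : ℝ)).smul_const v).const_add v
  have h₁ : HasDerivAt (fun t : ℝ => m.N (v + t • v)) (fderiv ℝ m.N v v) 0 := by
    have hN : HasFDerivAt m.N (fderiv ℝ m.N v) (v + (0 : ℝ) • v) := by
      simpa using (m.differentiableAt hv).hasFDerivAt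
    exact hN.comp_hasDerivAt (0 : ℝ) hline
  have h₂ : HasDerivAt (fun t : ℝ => (1 + t) * m.N v) (m.N v) 0 := by
    simpa using ((hasDerivAt_id (0 : ℝ)).const_add 1).mul_const (m.N v)
  refine h₁.unique (h₂.congr_of_eventuallyEq ?_)
  filter_upwards [lt_mem_nhds (show (-1 : ℝ) < 0 by norm_num)] with t ht
  have : v + t • v = (1 + t) • v := by rw [add_smul, one_smul]
  rw [this, m.smul_eq, abs_of_pos (by linarith)]

lemma gradient_ne_zero {v : E3} (hv : v ≠ 0) : gradient m.N v ≠ 0 := by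
  intro h
  have h' : fderiv ℝ m.N v = 0 := by rw [← toDual_gradient, h, map_zero]
  have := m.fderiv_apply_self hv
  rw [h', zero_apply] at this
  exact hv ((m.eq_zero_iff v).1 this.symm)

/-- The norm is stationary in every direction of a plane to which `v` is Birkhoff orthogonal. -/
lemma BirkhoffOrth.fderiv_eq_zero {m : MinkowskiNorm3} {v : E3} (hv : v ≠ 0) {H : Submodule ℝ E3}
    (h : m.BirkhoffOrth v H) {w : E3} (hw : w ∈ H) : fderiv ℝ m.N v w = 0 := by
  have hline : HasDerivAt (fun t : ℝ => v + t • w) w 0 := by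
    simpa using ((hasDerivAt_id (0 : ℝ)).smul_const w).const_add v
  have hN : HasFDerivAt m.N (fderiv ℝ m.N v) (v + (0 : ℝ) • w) := by
    simpa using (m.differentiableAt hv).hasFDerivAt
  have hmin : IsLocalMin (fun t : ℝ => m.N (v + t • w)) 0 :=
    Filter.Eventually.of_forall fun t => by simpa using h _ (H.smul_mem t hw)
  exact hmin.hasDerivAt_eq_zero (hN.comp_hasDerivAt (0 : ℝ) hline)

/-- On tangent vectors, the second fundamental form of `∂B` is the normalized Hessian of `N`. -/
lemma inner_duInv {v : E3} (hv : v ≠ 0) (x : E3) {y : E3} (hy : fderiv ℝ m.N v y = 0) :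
    ⟪m.duInv v x, y⟫_ℝ = ‖gradient m.N v‖⁻¹ * fderiv ℝ (fderiv ℝ m.N) v x y := by
  let L : (E3 →L[ℝ] ℝ) →L[ℝ] E3 := LinearMap.toContinuousLinearMap
    { toFun := (InnerProductSpace.toDual ℝ E3).symm
      map_add' := map_add _
      map_smul' := fun c φ => by simp }
  have hL : ∀ φ : E3 →L[ℝ] ℝ, ⟪L φ, y⟫_ℝ = φ y := fun φ =>
    InnerProductSpace.toDual_symm_apply
  have hgrad : HasFDerivAt (gradient m.N) (L.comp (fderiv ℝ (fderiv ℝ m.N) v)) v :=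
    L.hasFDerivAt.comp v (m.differentiableAt_fderiv hv).hasFDerivAt
  have hscal : DifferentiableAt ℝ (fun z => ‖gradient m.N z‖⁻¹) v :=
    (hgrad.differentiableAt.norm ℝ (m.gradient_ne_zero hv)).inv
      (norm_ne_zero_iff.2 (m.gradient_ne_zero hv))
  have hsphere : HasFDerivAt m.sphereGauss _ v := hscal.hasFDerivAt.smul hgrad
  have hperp : ⟪gradient m.N v, y⟫_ℝ = 0 := by
    rw [gradient, InnerProductSpace.toDual_symm_apply, hy]
  rw [duInv, hsphere.fderiv]
  simp [inner_add_left, inner_smul_left, hperp, hL]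

end MinkowskiNorm3

namespace BSurface

variable {m : MinkowskiNorm3} (S : BSurface m) {p : P2}

lemma η_ne_zero (hp : p ∈ S.U) : S.η p ≠ 0 := m.ne_zero_of_unit (S.unit_η p hp)

lemma hasFDerivAt_η (hp : p ∈ S.U) : HasFDerivAt S.η (fderiv ℝ S.η p) p :=
  ((S.smooth_η.contDiffAt (S.isOpen.mem_nhds hp)).differentiableAt (by simp)).hasFDerivAt

lemma contDiffAt_f (hp : p ∈ S.U) : ContDiffAt ℝ 2 S.f p :=
  contDiffAt_infty.1 (S.smooth_f.contDiffAt (S.isOpen.mem_nhds hp)) 2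

lemma fderiv_norm_tangent (hp : p ∈ S.U) (v : P2) : fderiv ℝ m.N (S.η p) (fderiv ℝ S.f p v) = 0 :=
  MinkowskiNorm3.BirkhoffOrth.fderiv_eq_zero (S.η_ne_zero hp)
    (H := LinearMap.range (fderiv ℝ S.f p : P2 →ₗ[ℝ] E3))
    (S.birkhoff p hp) ⟨v, rfl⟩

lemma fderiv_norm_fderiv_η (hp : p ∈ S.U) (v : P2) : fderiv ℝ m.N (S.η p) (fderiv ℝ S.η p v) = 0 := by
  have hcomp := (m.differentiableAt (S.η_ne_zero hp)).hasFDerivAt.comp p (S.hasFDerivAt_η hp)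
  have hconst : HasFDerivAt (m.N ∘ S.η) (0 : P2 →L[ℝ] ℝ) p := by
    refine (hasFDerivAt_const (1 : ℝ) p).congr_of_eventuallyEq ?_
    filter_upwards [S.isOpen.mem_nhds hp] with q hq using S.unit_η q hq
  simpa using congrArg (fun L : P2 →L[ℝ] ℝ => L v) (hcomp.unique hconst)

/-- The tangent plane of the surface at `p` is the tangent plane of `∂B` at `η p`. -/
lemma exists_fderiv_eq (hp : p ∈ S.U) {y : E3} (hy : fderiv ℝ m.N (S.η p) y = 0) :
    ∃ w, fderiv ℝ S.f p w = y := by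
  have hle : LinearMap.range (fderiv ℝ S.f p : P2 →ₗ[ℝ] E3) ≤
      LinearMap.ker (fderiv ℝ m.N (S.η p) : E3 →ₗ[ℝ] ℝ) := by
    rintro _ ⟨w, rfl⟩
    exact S.fderiv_norm_tangent hp w
  have hrange : Module.finrank ℝ (LinearMap.range (fderiv ℝ S.f p : P2 →ₗ[ℝ] E3)) = 2 := by
    rw [LinearMap.finrank_range_of_inj (S.immersion p hp)]
    simp
  have hker : Module.finrank ℝ (LinearMap.ker (fderiv ℝ m.N (S.η p) : E3 →ₗ[ℝ] ℝ)) < 3 := by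
    have hne : LinearMap.ker (fderiv ℝ m.N (S.η p) : E3 →ₗ[ℝ] ℝ) ≠ ⊤ := by
      intro h
      have hmem : S.η p ∈ LinearMap.ker (fderiv ℝ m.N (S.η p) : E3 →ₗ[ℝ] ℝ) := h ▸ trivial
      have h0 : fderiv ℝ m.N (S.η p) (S.η p) = 0 := hmem
      rw [m.fderiv_apply_self (S.η_ne_zero hp), S.unit_η p hp] at h0
      exact one_ne_zero h0
    simpa using Submodule.finrank_lt hne
  have heq := Submodule.eq_of_le_of_finrank_le hle (by omega)
  have hmem : y ∈ LinearMap.range (fderiv ℝ S.f p : P2 →ₗ[ℝ] E3) := heq ▸ hy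
  exact hmem

/-- Differentiating `dN_η (df w) = 0` along the surface. -/
lemma hessian_fderiv_η_add (hp : p ∈ S.U) (v w : P2) :
    fderiv ℝ (fderiv ℝ m.N) (S.η p) (fderiv ℝ S.η p v) (fderiv ℝ S.f p w) +
      fderiv ℝ m.N (S.η p) (fderiv ℝ (fderiv ℝ S.f) p v w) = 0 := by
  have hdN := (m.differentiableAt_fderiv (S.η_ne_zero hp)).hasFDerivAt.comp p (S.hasFDerivAt_η hp)
  have hdf : HasFDerivAt (fderiv ℝ S.f) (fderiv ℝ (fderiv ℝ S.f) p) p :=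
    (((S.contDiffAt_f hp).fderiv_right (m := 1)
      one_add_one_eq_two.le).differentiableAt (by simp)).hasFDerivAt
  have hprod := hdN.clm_apply (hdf.clm_apply (hasFDerivAt_const w p))
  have hzero : HasFDerivAt
      (fun q => (fderiv ℝ m.N ∘ S.η) q (fderiv ℝ S.f q w)) (0 : P2 →L[ℝ] ℝ) p := by
    refine (hasFDerivAt_const (0 : ℝ) p).congr_of_eventuallyEq ?_
    filter_upwards [S.isOpen.mem_nhds hp] with q hq using S.fderiv_norm_tangent hq w
  have := congrArg (fun L : P2 →L[ℝ] ℝ => L v) (hprod.unique hzero)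
  simpa [add_comm] using this

/-- The shape operator `dη` is self-adjoint for the Hessian of the norm. -/
lemma hessian_fderiv_η_comm (hp : p ∈ S.U) (v w : P2) :
    fderiv ℝ (fderiv ℝ m.N) (S.η p) (fderiv ℝ S.f p v) (fderiv ℝ S.η p w) =
      fderiv ℝ (fderiv ℝ m.N) (S.η p) (fderiv ℝ S.f p w) (fderiv ℝ S.η p v) := by
  have hN := m.isSymmSndFDerivAt (S.η_ne_zero hp)
  have hf : IsSymmSndFDerivAt ℝ S.f p :=
    (S.contDiffAt_f hp).isSymmSndFDerivAt (by simp)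
  have hvw := S.hessian_fderiv_η_add hp v w
  have hwv := S.hessian_fderiv_η_add hp w v
  rw [hf.eq v w] at hvw
  rw [hN.eq (fderiv ℝ S.f p v), hN.eq (fderiv ℝ S.f p w)]
  linarith

lemma fderiv_f_ne_zero (hp : p ∈ S.U) {v : P2} (hv : v ≠ 0) : fderiv ℝ S.f p v ≠ 0 := fun h =>
  hv (S.immersion p hp (by rw [h, map_zero]))

lemma inner_duInv_pos (hp : p ∈ S.U) (hadm : m.Admissible) {v : P2} (hv : v ≠ 0) :
    0 < ⟪m.duInv (S.η p) (fderiv ℝ S.f p v), fderiv ℝ S.f p v⟫_ℝ :=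
  hadm _ (S.unit_η p hp) _ (S.fderiv_f_ne_zero hp hv) (S.fderiv_norm_tangent hp v)

lemma normalCurv_eq_of_umbilic (hp : p ∈ S.U) (hadm : m.Admissible) {lam : ℝ}
    (h : ∀ v : P2, fderiv ℝ S.η p v = lam • fderiv ℝ S.f p v) {v : P2} (hv : v ≠ 0) :
    normalCurv m S.f S.η p v = lam := by
  rw [normalCurv, h v, inner_smul_right, mul_div_cancel_right₀ _ (S.inner_duInv_pos hp hadm hv).ne']

lemma umbilic_of_normalCurv_eq (hp : p ∈ S.U) (hadm : m.Admissible) {c : ℝ}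
    (h : ∀ v : P2, v ≠ 0 → normalCurv m S.f S.η p v = c) (v : P2) :
    fderiv ℝ S.η p v = c • fderiv ℝ S.f p v := by
  set H := fderiv ℝ (fderiv ℝ m.N) (S.η p)
  set A := fderiv ℝ S.f p
  set D := fderiv ℝ S.η p
  have hη := S.η_ne_zero hp
  have hg : ‖gradient m.N (S.η p)‖⁻¹ ≠ 0 :=
    inv_ne_zero (norm_ne_zero_iff.2 (m.gradient_ne_zero hη))
  have hdiag : ∀ u, H (A u) (D u) = c * H (A u) (A u) := by
    intro u
    rcases eq_or_ne u 0 with rfl | hu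
    · simp
    have hc := h u hu
    rw [normalCurv, div_eq_iff (S.inner_duInv_pos hp hadm hu).ne',
      m.inner_duInv hη _ (S.fderiv_norm_fderiv_η hp u),
      m.inner_duInv hη _ (S.fderiv_norm_tangent hp u)] at hc
    exact mul_left_cancel₀ hg (by linear_combination hc)
  have hpolar : ∀ u w, H (A u) (D w) = c * H (A u) (A w) := by
    intro u w
    have hadd := hdiag (u + w)
    simp only [map_add, add_apply] at hadd
    have hsymmD : H (A u) (D w) = H (A w) (D u) := S.hessian_fderiv_η_comm hp u w
    have hsymm : H (A u) (A w) = H (A w) (A u) := (m.isSymmSndFDerivAt hη).eq _ _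
    linear_combination (1 / 2) * (hadd - hdiag u - hdiag w + hsymmD) - (c / 2) * hsymm
  have htan : fderiv ℝ m.N (S.η p) (D v - c • A v) = 0 := by
    rw [map_sub, map_smul, S.fderiv_norm_fderiv_η hp v, S.fderiv_norm_tangent hp v]
    simp
  by_contra hne
  obtain ⟨w, hw⟩ := S.exists_fderiv_eq hp htan
  have hpos := hadm _ (S.unit_η p hp) _ (sub_ne_zero.2 hne) htan
  rw [m.inner_duInv hη _ htan] at hpos
  have hzero : H (D v - c • A v) (D v - c • A v) = 0 := by
    nth_rewrite 1 [← hw]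
    rw [map_sub, map_smul, hpolar w v, smul_eq_mul, sub_self]
  rw [hzero, mul_zero] at hpos
  exact lt_irrefl _ hpos

end BSurface

/-- A point `p ∈ M` is umbilic if and only if the Minkowski
normal curvature `k_{M,p}` is constant on `T_pM \ {0}`; in this case the
constant equals the common principal curvature of `M` at `p`. -/
theorem umbilic_iff_constant_normal_curvature (m : MinkowskiNorm3)
    (hadm : m.Admissible) (S : BSurface m) (p : P2) (hp : p ∈ S.U) :
    ((∃ lam : ℝ, ∀ v : P2, fderiv ℝ S.η p v = lam • fderiv ℝ S.f p v) ↔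
      (∃ c : ℝ, ∀ v : P2, v ≠ 0 → normalCurv m S.f S.η p v = c)) ∧
    (∀ lam : ℝ, (∀ v : P2, fderiv ℝ S.η p v = lam • fderiv ℝ S.f p v) →
      ∀ v : P2, v ≠ 0 → normalCurv m S.f S.η p v = lam) := by
  refine ⟨⟨?_, ?_⟩, fun lam h v hv => S.normalCurv_eq_of_umbilic hp hadm h hv⟩
  · rintro ⟨lam, h⟩
    exact ⟨lam, fun v hv => S.normalCurv_eq_of_umbilic hp hadm h hv⟩
  · rintro ⟨c, h⟩
    exact ⟨c, S.umbilic_of_normalCurv_eq hp hadm h⟩
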